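/- Let G be a spray on a nonempty open set U ⊆ ℝ^n (n ≥ 2) and dV a volume form on U. Then the Berwald–Weyl curvature of (G,dV) satisfies W^o_k = (1/(n−1)) R̂^m_{k∥m}, where R̂^i_k is the Riemann curvature of the projective spray Ĝ of (G,dV) and '∥' is the horizontal covariant derivative with respect to Ĝ. -/

import Mathlib

open scoped BigOperators
open MeasureTheory

noncomputable section BerwaldWeyl

/-- Points/vectors in local coordinates on `ℝⁿ`. -/
abbrev Vec (n : ℕ) := Fin n → ℝ

/-- Partial derivative in the base (`x`) variable along the `i`-th coordinate. -/
def pdx {n : ℕ} (f : Vec n → Vec n → ℝ) (i : Fin n) : Vec n → Vec n → ℝ :=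
  fun x y => fderiv ℝ (fun x' => f x' y) x (Pi.single i 1)

/-- Vertical derivative `f_{·i} = ∂f/∂y^i`. -/
def pdy {n : ℕ} (f : Vec n → Vec n → ℝ) (i : Fin n) : Vec n → Vec n → ℝ :=
  fun x y => fderiv ℝ (fun y' => f x y') y (Pi.single i 1)

/-- The slit fiber `ℝⁿ \ {0}`. -/
def slit (n : ℕ) : Set (Vec n) := {y | y ≠ 0}

/-- A spray on `U ⊆ ℝⁿ`: a family `G^i(x,y)`, smooth on `U × (ℝⁿ \ {0})` and
positively 2-homogeneous in `y`. -/
def IsSpray {n : ℕ} (U : Set (Vec n)) (G : Fin n → Vec n → Vec n → ℝ) : Prop :=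
  (∀ i, ContDiffOn ℝ (⊤ : ℕ∞) (fun p : Vec n × Vec n => G i p.1 p.2) (U ×ˢ slit n)) ∧
  (∀ i, ∀ x ∈ U, ∀ y ∈ slit n, ∀ c : ℝ, 0 < c → G i x (c • y) = c ^ 2 * G i x y)

/-- Nonlinear connection coefficients `N^i_j := ∂G^i/∂y^j`. -/
def Nc {n : ℕ} (G : Fin n → Vec n → Vec n → ℝ) (i j : Fin n) : Vec n → Vec n → ℝ :=
  pdy (G i) j

/-- Berwald connection coefficients `Γ^i_{jk} := ∂²G^i/∂y^j∂y^k`. -/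
def Γc {n : ℕ} (G : Fin n → Vec n → Vec n → ℝ) (i j k : Fin n) : Vec n → Vec n → ℝ :=
  pdy (pdy (G i) j) k

/-- Horizontal derivative of a scalar: `f_{|k} := δf/δx^k = ∂f/∂x^k - N^l_k ∂f/∂y^l`. -/
def hD {n : ℕ} (G : Fin n → Vec n → Vec n → ℝ) (f : Vec n → Vec n → ℝ) (k : Fin n) :
    Vec n → Vec n → ℝ :=
  fun x y => pdx f k x y - ∑ l, Nc G l k x y * pdy f l x y

/-- Horizontal covariant derivative `A_{j|m}` of a 1-form `A_j`. -/
def covD1 {n : ℕ} (G : Fin n → Vec n → Vec n → ℝ) (A : Fin n → Vec n → Vec n → ℝ)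
    (j m : Fin n) : Vec n → Vec n → ℝ :=
  fun x y => hD G (A j) m x y - ∑ l, A l x y * Γc G l j m x y

/-- Horizontal covariant derivative `A^i_{j|m}` of a (1,1)-tensor `A^i_j`. -/
def covD11 {n : ℕ} (G : Fin n → Vec n → Vec n → ℝ)
    (A : Fin n → Fin n → Vec n → Vec n → ℝ) (i j m : Fin n) : Vec n → Vec n → ℝ :=
  fun x y => hD G (A i j) m x y + ∑ l, A l j x y * Γc G i l m x y
    - ∑ l, A i l x y * Γc G l j m x y

/-- Horizontal covariant derivative `B^i_{jk|m}` of a (1,2)-tensor `B^i_{jk}`. -/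
def covD12 {n : ℕ} (G : Fin n → Vec n → Vec n → ℝ)
    (B : Fin n → Fin n → Fin n → Vec n → Vec n → ℝ) (i j k m : Fin n) : Vec n → Vec n → ℝ :=
  fun x y => hD G (B i j k) m x y + ∑ l, B l j k x y * Γc G i l m x y
    - ∑ l, B i l k x y * Γc G l j m x y - ∑ l, B i j l x y * Γc G l k m x y

/-- Riemann curvature `R^i_k`. -/
def Riem {n : ℕ} (G : Fin n → Vec n → Vec n → ℝ) (i k : Fin n) : Vec n → Vec n → ℝ :=
  fun x y => 2 * pdx (G i) k x y - ∑ j, y j * pdy (pdx (G i) j) k x y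
    + 2 * ∑ j, G j x y * Γc G i j k x y - ∑ s, Nc G i s x y * Nc G s k x y

/-- Ricci scalar `R := R^m_m/(n-1)`. -/
def Ricci {n : ℕ} (G : Fin n → Vec n → Vec n → ℝ) : Vec n → Vec n → ℝ :=
  fun x y => (∑ m, Riem G m m x y) / ((n : ℝ) - 1)

/-- The Weyl-type curvature `T^i_k := R^i_k - (R δ^i_k - ½ R_{·k} y^i)`. -/
def Tcurv {n : ℕ} (G : Fin n → Vec n → Vec n → ℝ) (i k : Fin n) : Vec n → Vec n → ℝ :=
  fun x y => Riem G i k x y -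
    (Ricci G x y * (if i = k then 1 else 0) - (1/2) * pdy (Ricci G) k x y * y i)

/-- The χ-curvature `χ_i := -(1/3) T^m_{i·m}`. -/
def chiC {n : ℕ} (G : Fin n → Vec n → Vec n → ℝ) (i : Fin n) : Vec n → Vec n → ℝ :=
  fun x y => -(1/3) * ∑ m, pdy (Tcurv G m i) m x y

/-- The Weyl curvature `W^i_k := T^i_k + (3χ_k/(n+1)) y^i`. -/
def Weyl {n : ℕ} (G : Fin n → Vec n → Vec n → ℝ) (i k : Fin n) : Vec n → Vec n → ℝ :=
  fun x y => Tcurv G i k x y + (3 * chiC G k x y / ((n : ℝ) + 1)) * y i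

/-- A volume form `dV = σ(x) dx` on `U`: `σ` smooth and positive. -/
def IsVolumeForm {n : ℕ} (U : Set (Vec n)) (σ : Vec n → ℝ) : Prop :=
  ContDiffOn ℝ (⊤ : ℕ∞) σ U ∧ ∀ x ∈ U, 0 < σ x

/-- The S-curvature of `(G, dV)`: `S := ∂G^m/∂y^m - y^m ∂(ln σ)/∂x^m`. -/
def Scurv {n : ℕ} (G : Fin n → Vec n → Vec n → ℝ) (σ : Vec n → ℝ) : Vec n → Vec n → ℝ :=
  fun x y => ∑ m, Nc G m m x y
    - ∑ m, y m * fderiv ℝ (fun x' => Real.log (σ x')) x (Pi.single m 1)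

/-- The projective spray `Ĝ^i := G^i - (S/(n+1)) y^i` of `(G, dV)`. -/
def Ghat {n : ℕ} (G : Fin n → Vec n → Vec n → ℝ) (σ : Vec n → ℝ) :
    Fin n → Vec n → Vec n → ℝ :=
  fun i x y => G i x y - (Scurv G σ x y / ((n : ℝ) + 1)) * y i

/-- The Berwald–Weyl curvature `W^o_k := R̂_{∥k} - ½ R̂_{·k∥m} y^m` of `(G, dV)`,
where all hatted quantities and `∥` are taken with respect to the projective spray `Ĝ`. -/
def BWeyl {n : ℕ} (G : Fin n → Vec n → Vec n → ℝ) (σ : Vec n → ℝ) (k : Fin n) :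
    Vec n → Vec n → ℝ :=
  fun x y => hD (Ghat G σ) (Ricci (Ghat G σ)) k x y
    - (1/2) * ∑ m, covD1 (Ghat G σ) (fun j => pdy (Ricci (Ghat G σ)) j) k m x y * y m


/-- Coordinate derivations on a commutative algebra of functions on a slit tangent bundle: the
base derivatives `X i = ∂/∂x^i`, the vertical derivatives `Y i = ∂/∂y^i` and the fiber
coordinates `y i`. -/
structure TangentFrame (ι A : Type*) [DecidableEq ι] [CommRing A] [Algebra ℝ A] where
  X : ι → Derivation ℝ A A
  Y : ι → Derivation ℝ A A
  y : ι → A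
  X_comm : ∀ i j a, X i (X j a) = X j (X i a)
  Y_comm : ∀ i j a, Y i (Y j a) = Y j (Y i a)
  XY_comm : ∀ i j a, X i (Y j a) = Y j (X i a)
  X_y : ∀ i j, X i (y j) = 0
  Y_y : ∀ i j, Y i (y j) = if i = j then 1 else 0

namespace TangentFrame

variable {ι A : Type*} [Fintype ι] [DecidableEq ι] [CommRing A] [Algebra ℝ A]
  (F : TangentFrame ι A) (G : ι → A)

/-- The horizontal derivation `δ/δx^k = ∂/∂x^k - N^l_k ∂/∂y^l`. -/
def δ (k : ι) : Derivation ℝ A A := F.X k - ∑ l, F.Y k (G l) • F.Y l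

/-- The curvature `R^i_{kl} = δN^i_l/δx^k - δN^i_k/δx^l` of the nonlinear connection. -/
def curv (i k l : ι) : A := F.δ G k (F.Y l (G i)) - F.δ G l (F.Y k (G i))

/-- The Riemann curvature `R^i_k` of the spray `G`. -/
def riem (i k : ι) : A :=
  2 * F.X k (G i) - ∑ j, F.y j * F.Y k (F.X j (G i))
    + 2 * ∑ j, G j * F.Y k (F.Y j (G i)) - ∑ s, F.Y s (G i) * F.Y k (G s)

/-- The Ricci curvature `R^m_m`. -/
def ric : A := ∑ m, F.riem G m m

/-- The horizontal covariant derivative of a 1-form. -/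
def cov1 (B : ι → A) (j m : ι) : A := F.δ G m (B j) - ∑ l, B l * F.Y m (F.Y j (G l))

/-- The horizontal covariant derivative of a (1,1)-tensor. -/
def cov11 (B : ι → ι → A) (i j m : ι) : A :=
  F.δ G m (B i j) + ∑ l, B l j * F.Y m (F.Y l (G i)) - ∑ l, B i l * F.Y m (F.Y j (G l))

/-- The Euler relation expressing 2-homogeneity of the spray in `y`. -/
def Euler2 : Prop := ∀ i, ∑ j, F.y j * F.Y j (G i) = 2 * G i

lemma δ_apply (k : ι) (a : A) : F.δ G k a = F.X k a - ∑ l, F.Y k (G l) * F.Y l a := by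
  have h : (∑ l, F.Y k (G l) • F.Y l) a = ∑ l, (F.Y k (G l) • F.Y l) a := by
    have h' := congrFun (map_sum (Derivation.coeFnAddMonoidHom (R := ℝ) (A := A) (M := A))
      (fun l => F.Y k (G l) • F.Y l) Finset.univ) a
    rw [Finset.sum_apply] at h'
    exact h'
  simp [δ, h]

lemma δ_y (k m : ι) : F.δ G k (F.y m) = -F.Y k (G m) := by
  simp [δ_apply, F.X_y, F.Y_y]

lemma curv_def (i k l : ι) :
    F.curv G i k l = F.δ G k (F.Y l (G i)) - F.δ G l (F.Y k (G i)) := rfl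

lemma curv_antisymm (i k l : ι) : F.curv G i k l = -F.curv G i l k := by
  simp [curv]

lemma δ_commutator (k l : ι) (a : A) :
    F.δ G k (F.δ G l a) - F.δ G l (F.δ G k a) = -∑ s, F.curv G s k l * F.Y s a := by
  have key (k l : ι) : F.δ G k (F.δ G l a) =
      F.X k (F.X l a) - (∑ s, F.Y k (G s) * F.Y s (F.X l a) + ∑ s, F.Y l (G s) * F.Y s (F.X k a))
        - ∑ s, F.δ G k (F.Y l (G s)) * F.Y s a
        + ∑ s, ∑ t, F.Y l (G s) * (F.Y k (G t) * F.Y t (F.Y s a)) := by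
    have hY (s : ι) : F.δ G k (F.Y s a)
        = F.Y s (F.X k a) - ∑ t, F.Y k (G t) * F.Y t (F.Y s a) := by
      rw [δ_apply, F.XY_comm]
    rw [F.δ_apply G l a, map_sub, map_sum, F.δ_apply G k (F.X l a)]
    simp only [Derivation.leibniz, smul_eq_mul, Finset.sum_add_distrib, hY, mul_sub,
      Finset.sum_sub_distrib, Finset.mul_sum, mul_comm (F.Y _ a)]
    ring
  have hsymm : ∑ s, ∑ t, F.Y l (G s) * (F.Y k (G t) * F.Y t (F.Y s a))
      = ∑ s, ∑ t, F.Y k (G s) * (F.Y l (G t) * F.Y t (F.Y s a)) := by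
    rw [Finset.sum_comm]
    refine Finset.sum_congr rfl fun s _ => Finset.sum_congr rfl fun t _ => ?_
    rw [F.Y_comm s t]; ring
  rw [key k l, key l k, hsymm, F.X_comm k l]
  simp only [curv, sub_mul, Finset.sum_sub_distrib]
  ring

lemma bianchi (i k l m : ι) :
    F.δ G m (F.curv G i k l) + F.δ G l (F.curv G i m k) + F.δ G k (F.curv G i l m)
      + (∑ s, F.curv G s k l * F.Y s (F.Y m (G i)) + ∑ s, F.curv G s m k * F.Y s (F.Y l (G i))
        + ∑ s, F.curv G s l m * F.Y s (F.Y k (G i))) = 0 := by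
  have h₁ := F.δ_commutator G k l (F.Y m (G i))
  have h₂ := F.δ_commutator G m k (F.Y l (G i))
  have h₃ := F.δ_commutator G l m (F.Y k (G i))
  rw [F.curv_def G i k l, F.curv_def G i m k, F.curv_def G i l m]
  simp only [map_sub]
  linear_combination h₁ + h₂ + h₃

variable {F G}

namespace Euler2

lemma deriv (h : F.Euler2 G) (i k : ι) :
    ∑ m, F.y m * F.Y m (F.Y k (G i)) = F.Y k (G i) := by
  have := congrArg (F.Y k) (h i)
  simp only [map_sum, Derivation.leibniz, smul_eq_mul, F.Y_y, Finset.sum_add_distrib,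
    two_mul, map_add, F.Y_comm k] at this
  simp only [mul_ite, mul_one, mul_zero, Finset.sum_ite_eq, Finset.mem_univ, if_true] at this
  linear_combination this

lemma sum_connection_mul (h : F.Euler2 G) (B : ι → A) (k : ι) :
    ∑ m, (∑ l, B l * F.Y m (F.Y k (G l))) * F.y m = ∑ l, B l * F.Y k (G l) := by
  simp only [Finset.sum_mul]
  rw [Finset.sum_comm]
  refine Finset.sum_congr rfl fun l _ => ?_
  conv_rhs => rw [← h.deriv l k, Finset.mul_sum]
  exact Finset.sum_congr rfl fun m _ => by ring

lemma sum_connection_mul' (h : F.Euler2 G) (B : ι → A) (i : ι) :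
    ∑ m, (∑ s, B s * F.Y s (F.Y m (G i))) * F.y m = ∑ s, B s * F.Y s (G i) := by
  simp only [Finset.sum_mul]
  rw [Finset.sum_comm]
  refine Finset.sum_congr rfl fun s _ => ?_
  conv_rhs => rw [← h.deriv i s, Finset.mul_sum]
  exact Finset.sum_congr rfl fun m _ => by rw [F.Y_comm s m]; ring

lemma riem_eq (h : F.Euler2 G) (i k : ι) : F.riem G i k = ∑ m, F.curv G i k m * F.y m := by
  have e₁ : ∑ m, F.δ G k (F.Y m (G i)) * F.y m
      = 2 * F.X k (G i) - ∑ s, F.Y s (G i) * F.Y k (G s) := by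
    have h1 : F.δ G k (∑ m, F.y m * F.Y m (G i)) = F.δ G k (2 * G i) := by rw [h i]
    have h2 : F.δ G k (2 * G i) = 2 * F.X k (G i) - 2 * ∑ s, F.Y s (G i) * F.Y k (G s) := by
      rw [two_mul, map_add, δ_apply]
      simp only [mul_comm (F.Y k _)]
      ring
    rw [h2, map_sum] at h1
    simp only [Derivation.leibniz, smul_eq_mul, δ_y, Finset.sum_add_distrib, mul_neg,
      Finset.sum_neg_distrib, mul_comm (F.y _)] at h1
    linear_combination h1
  have e₂ : ∑ m, F.δ G m (F.Y k (G i)) * F.y m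
      = ∑ j, F.y j * F.Y k (F.X j (G i)) - 2 * ∑ j, G j * F.Y k (F.Y j (G i)) := by
    simp only [δ_apply, F.XY_comm, mul_sub, Finset.sum_sub_distrib, mul_comm _ (F.y _)]
    congr 1
    simp only [Finset.mul_sum]
    rw [Finset.sum_comm]
    refine Finset.sum_congr rfl fun l _ => ?_
    rw [F.Y_comm k, ← mul_assoc, ← h l, Finset.sum_mul]
    exact Finset.sum_congr rfl fun m _ => by ring
  simp only [curv, sub_mul, Finset.sum_sub_distrib, e₁, e₂, riem]
  ring

/-- The contracted second Bianchi identity. -/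
lemma contracted_bianchi (h : F.Euler2 G) (k : ι) :
    F.δ G k (F.ric G) + ∑ m, F.cov1 G (fun j => ∑ i, F.curv G i j i) k m * F.y m
      = ∑ m, F.cov11 G (F.riem G) m k m := by
  have hB : ∑ i, ∑ m, F.y m * (F.δ G m (F.curv G i k i) + F.δ G i (F.curv G i m k)
      + F.δ G k (F.curv G i i m) + (∑ s, F.curv G s k i * F.Y s (F.Y m (G i))
        + ∑ s, F.curv G s m k * F.Y s (F.Y i (G i))
        + ∑ s, F.curv G s i m * F.Y s (F.Y k (G i)))) = 0 := by
    simp only [bianchi, mul_zero, Finset.sum_const_zero]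
  have hRic : F.δ G k (F.ric G) = ∑ i, ∑ m, F.y m * F.δ G k (F.curv G i i m)
      - ∑ i, ∑ m, F.curv G i i m * F.Y k (G m) := by
    simp only [ric, h.riem_eq, map_sum, Derivation.leibniz, smul_eq_mul, δ_y, mul_neg,
      Finset.sum_add_distrib, Finset.sum_neg_distrib]
    ring
  have hp : ∑ m, F.cov1 G (fun j => ∑ i, F.curv G i j i) k m * F.y m
      = ∑ i, ∑ m, F.y m * F.δ G m (F.curv G i k i)
        + ∑ i, ∑ m, F.curv G i i m * F.Y k (G m) := by
    have hΓ : ∑ m, (∑ l, (∑ i, F.curv G i l i) * F.Y m (F.Y k (G l))) * F.y m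
        = -∑ i, ∑ m, F.curv G i i m * F.Y k (G m) := by
      rw [h.sum_connection_mul, ← Finset.sum_neg_distrib]
      simp only [Finset.sum_mul, ← Finset.sum_neg_distrib]
      rw [Finset.sum_comm]
      refine Finset.sum_congr rfl fun i _ => Finset.sum_congr rfl fun m _ => ?_
      rw [F.curv_antisymm G i m i, neg_mul]
    simp only [cov1, sub_mul, Finset.sum_sub_distrib, hΓ, map_sum]
    simp only [Finset.sum_mul]
    rw [Finset.sum_comm]
    simp only [mul_comm _ (F.y _), sub_neg_eq_add]
  have hR : ∑ m, F.cov11 G (F.riem G) m k m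
      = -∑ i, ∑ m, F.y m * F.δ G i (F.curv G i m k)
        - ∑ i, ∑ m, F.y m * ∑ s, F.curv G s k i * F.Y s (F.Y m (G i))
        - ∑ i, ∑ m, F.y m * ∑ s, F.curv G s m k * F.Y s (F.Y i (G i))
        - ∑ i, ∑ m, F.y m * ∑ s, F.curv G s i m * F.Y s (F.Y k (G i)) := by
    have hδ : ∑ i, F.δ G i (F.riem G i k) = -∑ i, ∑ m, F.y m * F.δ G i (F.curv G i m k)
        - ∑ i, ∑ m, F.curv G i k m * F.Y i (G m) := by
      simp only [h.riem_eq, map_sum, Derivation.leibniz, smul_eq_mul, δ_y, mul_neg,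
        Finset.sum_add_distrib, Finset.sum_neg_distrib, F.curv_antisymm G _ k, map_neg]
      ring
    have h₁ : ∑ i, ∑ m, F.y m * ∑ s, F.curv G s k i * F.Y s (F.Y m (G i))
        = ∑ i, ∑ m, F.curv G i k m * F.Y i (G m) := by
      rw [Finset.sum_comm (f := fun i m => F.curv G i k m * F.Y i (G m))]
      refine Finset.sum_congr rfl fun i _ => ?_
      rw [← h.sum_connection_mul' (fun s => F.curv G s k i)]
      exact Finset.sum_congr rfl fun m _ => by rw [mul_comm]
    have h₂ : ∑ i, ∑ m, F.y m * ∑ s, F.curv G s m k * F.Y s (F.Y i (G i))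
        = -∑ i, ∑ l, F.riem G l k * F.Y i (F.Y l (G i)) := by
      simp only [h.riem_eq, Finset.mul_sum, Finset.sum_mul, ← Finset.sum_neg_distrib]
      refine Finset.sum_congr rfl fun i _ => ?_
      rw [Finset.sum_comm]
      refine Finset.sum_congr rfl fun l _ => Finset.sum_congr rfl fun m _ => ?_
      rw [F.curv_antisymm G l m k, F.Y_comm l i]; ring
    have h₃ : ∑ i, ∑ m, F.y m * ∑ s, F.curv G s i m * F.Y s (F.Y k (G i))
        = ∑ i, ∑ l, F.riem G i l * F.Y i (F.Y k (G l)) := by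
      rw [Finset.sum_comm (f := fun i l => F.riem G i l * F.Y i (F.Y k (G l)))]
      refine Finset.sum_congr rfl fun i _ => ?_
      simp only [h.riem_eq, Finset.mul_sum, Finset.sum_mul]
      rw [Finset.sum_comm]
      exact Finset.sum_congr rfl fun l _ => Finset.sum_congr rfl fun m _ => by ring
    simp only [cov11, Finset.sum_sub_distrib, Finset.sum_add_distrib]
    rw [hδ, h₁, h₂, h₃]
    ring
  simp only [mul_add, Finset.sum_add_distrib] at hB
  rw [hRic, hp, hR]
  linear_combination hB

end Euler2

/-- If the divergence `∂G^m/∂y^m` is the fiberwise linear function of a closed 1-form on the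
base, then `R^m_{km} = -½ Ric_{·k}`. -/
lemma Y_ric_eq {f : ι → A} (hY : ∀ i j, F.Y i (f j) = 0) (hX : ∀ i j, F.X i (f j) = F.X j (f i))
    (hdiv : ∑ m, F.Y m (G m) = ∑ m, F.y m * f m) (k : ι) :
    F.Y k (F.ric G) = -(2 * ∑ i, F.curv G i k i) := by
  have hYdiv (j : ι) : ∑ m, F.Y m (F.Y j (G m)) = f j := by
    have := congrArg (F.Y j) hdiv
    simpa [F.Y_y, hY, F.Y_comm j] using this
  have hXdiv (j : ι) : ∑ m, F.Y m (F.X j (G m)) = ∑ l, F.y l * F.X j (f l) := by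
    have := congrArg (F.X j) hdiv
    simpa [F.X_y, F.XY_comm j] using this
  have hcurv : ∑ i, F.curv G i k i = ∑ m, F.y m * F.X k (f m) - ∑ m, f m * F.Y k (G m)
      - F.Y k (∑ m, F.X m (G m)) + ∑ i, ∑ l, F.Y i (G l) * F.Y l (F.Y k (G i)) := by
    simp only [curv, Finset.sum_sub_distrib, ← map_sum, hdiv]
    simp only [map_sum, Derivation.leibniz, smul_eq_mul, δ_y, Finset.sum_add_distrib]
    simp only [δ_apply, hY, F.XY_comm, mul_zero, Finset.sum_const_zero, sub_zero,
      Finset.sum_sub_distrib, mul_neg, Finset.sum_neg_distrib]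
    ring
  have hric : F.ric G = 2 * ∑ m, F.X m (G m) - ∑ j, F.y j * ∑ l, F.y l * F.X j (f l)
      + 2 * ∑ j, G j * f j - ∑ m, ∑ s, F.Y s (G m) * F.Y m (G s) := by
    simp only [← hXdiv]
    simp only [← hYdiv, ric, riem, Finset.sum_add_distrib, Finset.sum_sub_distrib,
      ← Finset.mul_sum]
    rw [Finset.sum_comm (f := fun m j => F.y j * F.Y m (F.X j (G m))),
      Finset.sum_comm (f := fun m j => G j * F.Y m (F.Y j (G m)))]
    simp only [Finset.mul_sum]
  have hsq : ∑ m, ∑ s, F.Y m (G s) * F.Y k (F.Y s (G m))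
      = ∑ m, ∑ s, F.Y s (G m) * F.Y k (F.Y m (G s)) := Finset.sum_comm
  rw [hcurv, hric]
  simp only [two_mul, map_add, map_sub, map_sum, Derivation.leibniz, smul_eq_mul, F.Y_y,
    ← F.XY_comm _ k (f _), hY, map_zero, mul_zero, zero_add, mul_ite, mul_one,
    Finset.sum_add_distrib, Finset.sum_ite_eq, Finset.mem_univ, if_true, F.Y_comm _ k, hsq,
    hX _ k]
  ring

variable (F G)

lemma cov1_smul (r : ℝ) (B : ι → A) (j m : ι) :
    F.cov1 G (fun i => r • B i) j m = r • F.cov1 G B j m := by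
  simp [cov1, smul_sub, Finset.smul_sum]

/-- The S-curvature of `G` with respect to the volume form with log-density `g`. -/
def sCurv (g : A) : A := ∑ m, F.Y m (G m) - ∑ m, F.y m * F.X m g

/-- The projective spray `G^i - c S y^i`. -/
def proj (g : A) (c : ℝ) (i : ι) : A := G i - (c • F.sCurv G g) * F.y i

variable {F G}

lemma Euler2.sCurv (h : F.Euler2 G) {g : A} (hg : ∀ i, F.Y i g = 0) :
    ∑ j, F.y j * F.Y j (F.sCurv G g) = F.sCurv G g := by
  have hS (j : ι) : F.Y j (F.sCurv G g) = ∑ m, F.Y j (F.Y m (G m)) - F.X j g := by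
    simp [TangentFrame.sCurv, F.Y_y, ← F.XY_comm, hg]
  simp only [hS, mul_sub, Finset.sum_sub_distrib, Finset.mul_sum]
  rw [Finset.sum_comm]
  simp only [h.deriv, TangentFrame.sCurv]

lemma Euler2.proj (h : F.Euler2 G) {g : A} (hg : ∀ i, F.Y i g = 0) (c : ℝ) :
    F.Euler2 (F.proj G g c) := by
  intro i
  have hS := h.sCurv hg
  have hY (j : ι) : F.Y j (F.proj G g c i) = F.Y j (G i)
      - ((c • F.sCurv G g) * (if j = i then 1 else 0) + F.y i * c • F.Y j (F.sCurv G g)) := by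
    simp [TangentFrame.proj, F.Y_y]
  have hy : ∑ j, F.y j * (F.y i * c • F.Y j (F.sCurv G g)) = (c • F.sCurv G g) * F.y i := by
    conv_rhs => rw [← hS, Finset.smul_sum, Finset.sum_mul]
    refine Finset.sum_congr rfl fun j _ => ?_
    simp only [Algebra.smul_def]; ring
  simp only [hY, mul_sub, mul_add, Finset.sum_sub_distrib, Finset.sum_add_distrib, h i, hy]
  simp only [mul_ite, mul_one, mul_zero, Finset.sum_ite_eq', Finset.mem_univ, if_true,
    TangentFrame.proj]
  ring

lemma Euler2.sum_Y_proj (h : F.Euler2 G) {g : A} (hg : ∀ i, F.Y i g = 0) {c : ℝ}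
    (hc : c * (Fintype.card ι + 1) = 1) :
    ∑ m, F.Y m (F.proj G g c m) = ∑ m, F.y m * F.X m g := by
  have hS := h.sCurv hg
  have hy : ∑ j, F.y j * c • F.Y j (F.sCurv G g) = c • F.sCurv G g := by
    conv_rhs => rw [← hS, Finset.smul_sum]
    simp only [mul_smul_comm]
  have hc' : algebraMap ℝ A c * (Fintype.card ι + 1) = 1 := by
    simpa using congrArg (algebraMap ℝ A) hc
  have hsum : ∑ m, F.Y m (F.proj G g c m)
      = ∑ m, F.Y m (G m) - (Fintype.card ι * c • F.sCurv G g + c • F.sCurv G g) := by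
    have hY (m : ι) : F.Y m (F.proj G g c m)
        = F.Y m (G m) - (c • F.sCurv G g + F.y m * c • F.Y m (F.sCurv G g)) := by
      simp [TangentFrame.proj, F.Y_y]
    simp only [hY, Finset.sum_sub_distrib, Finset.sum_add_distrib, hy]
    simp
  have hdef : F.sCurv G g = ∑ m, F.Y m (G m) - ∑ m, F.y m * F.X m g := rfl
  rw [hsum]
  simp only [Algebra.smul_def]
  linear_combination -hdef - F.sCurv G g * hc'

/-- The Berwald–Weyl curvature of a homogeneous spray whose divergence is the fiberwise linear
function of an exact 1-form is a multiple of the divergence of the Riemann curvature. -/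
theorem Euler2.berwaldWeyl_eq (h : F.Euler2 G) {g : A} (hg : ∀ i, F.Y i g = 0)
    (hdiv : ∑ m, F.Y m (G m) = ∑ m, F.y m * F.X m g) (r : ℝ) (k : ι) :
    F.δ G k (r • F.ric G)
        - (1 / 2 : ℝ) • ∑ m, F.cov1 G (fun j => F.Y j (r • F.ric G)) k m * F.y m
      = r • ∑ m, F.cov11 G (F.riem G) m k m := by
  have hY (j : ι) : F.Y j (r • F.ric G) = (-(2 * r)) • ∑ i, F.curv G i j i := by
    rw [Derivation.map_smul, Y_ric_eq (f := fun i => F.X i g)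
      (fun i j => by rw [← F.XY_comm, hg, map_zero]) (fun i j => F.X_comm i j g) hdiv]
    rw [two_mul, two_mul]
    module
  simp only [hY, cov1_smul, ← h.contracted_bianchi k, smul_mul_assoc, ← Finset.smul_sum,
    Derivation.map_smul]
  module

end TangentFrame

section SmoothFunctions

open scoped ContDiff

variable {E : Type*} [NormedAddCommGroup E] [NormedSpace ℝ E]

/-- The algebra of smooth real functions on a set `s`. -/
def smoothFun (s : Set E) : Subalgebra ℝ (s → ℝ) where
  carrier := {F | ∃ f : E → ℝ, ContDiffOn ℝ ∞ f s ∧ ∀ p : s, f p = F p}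
  mul_mem' := by
    rintro F H ⟨f, hf, hF⟩ ⟨h, hh, hH⟩
    exact ⟨fun p => f p * h p, hf.mul hh, fun p => by simp [hF, hH]⟩
  add_mem' := by
    rintro F H ⟨f, hf, hF⟩ ⟨h, hh, hH⟩
    exact ⟨fun p => f p + h p, hf.add hh, fun p => by simp [hF, hH]⟩
  algebraMap_mem' r := ⟨fun _ => r, contDiffOn_const, fun p => by simp⟩

variable {s : Set E}

/-- The extension by zero of a smooth function on `s`. -/
def zeroExt (a : smoothFun s) : E → ℝ := Function.extend Subtype.val a.1 0

lemma zeroExt_apply (a : smoothFun s) (p : s) : zeroExt a p = a.1 p :=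
  Subtype.val_injective.extend_apply _ _ _

lemma zeroExt_contDiffOn (a : smoothFun s) : ContDiffOn ℝ ∞ (zeroExt a) s := by
  obtain ⟨f, hf, hF⟩ := a.2
  exact hf.congr fun p hp => by rw [zeroExt_apply a ⟨p, hp⟩, ← hF ⟨p, hp⟩]

lemma zeroExt_eventuallyEq (hs : IsOpen s) {a : smoothFun s} {f : E → ℝ}
    (hf : ∀ p : s, f p = a.1 p) (p : s) : zeroExt a =ᶠ[nhds p.1] f := by
  filter_upwards [hs.mem_nhds p.2] with q hq
  rw [zeroExt_apply a ⟨q, hq⟩, ← hf ⟨q, hq⟩]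

lemma zeroExt_contDiffAt (hs : IsOpen s) (a : smoothFun s) (p : s) :
    ContDiffAt ℝ ∞ (zeroExt a) p :=
  (zeroExt_contDiffOn a).contDiffAt (hs.mem_nhds p.2)

lemma zeroExt_differentiableAt (hs : IsOpen s) (a : smoothFun s) (p : s) :
    DifferentiableAt ℝ (zeroExt a) p :=
  (zeroExt_contDiffAt hs a p).differentiableAt (by simp)

/-- The derivative in a fixed direction, as a derivation on smooth functions. -/
def dirDeriv (hs : IsOpen s) (v : E) : Derivation ℝ (smoothFun s) (smoothFun s) :=
  Derivation.mk'
    { toFun := fun a => ⟨fun p => fderiv ℝ (zeroExt a) p v, fun p => fderiv ℝ (zeroExt a) p v,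
        ((zeroExt_contDiffOn a).fderiv_of_isOpen hs (by simp)).clm_apply contDiffOn_const,
        fun _ => rfl⟩
      map_add' := fun a b => by
        ext p
        change fderiv ℝ (zeroExt (a + b)) p v = fderiv ℝ (zeroExt a) p v + fderiv ℝ (zeroExt b) p v
        rw [(zeroExt_eventuallyEq hs (a := a + b) (f := zeroExt a + zeroExt b)
          (fun p => by simp [zeroExt_apply]) p).fderiv_eq,
          fderiv_add (zeroExt_differentiableAt hs a p) (zeroExt_differentiableAt hs b p)]
        rfl
      map_smul' := fun r a => by
        ext p
        change fderiv ℝ (zeroExt (r • a)) p v = r * fderiv ℝ (zeroExt a) p v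
        rw [(zeroExt_eventuallyEq hs (a := r • a) (f := r • zeroExt a)
          (fun p => by simp [zeroExt_apply]) p).fderiv_eq,
          fderiv_const_smul (zeroExt_differentiableAt hs a p)]
        rfl }
    fun a b => by
      ext p
      change fderiv ℝ (zeroExt (a * b)) p v
        = a.1 p * fderiv ℝ (zeroExt b) p v + b.1 p * fderiv ℝ (zeroExt a) p v
      rw [(zeroExt_eventuallyEq hs (a := a * b) (f := zeroExt a * zeroExt b)
        (fun p => by simp [zeroExt_apply]) p).fderiv_eq,
        fderiv_mul (zeroExt_differentiableAt hs a p) (zeroExt_differentiableAt hs b p)]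
      simp [zeroExt_apply]

lemma dirDeriv_apply (hs : IsOpen s) (v : E) (a : smoothFun s) (p : s) :
    (dirDeriv hs v a).1 p = fderiv ℝ (zeroExt a) p v := rfl

lemma dirDeriv_eq (hs : IsOpen s) (v : E) {a : smoothFun s} {f : E → ℝ}
    (hf : ∀ p : s, f p = a.1 p) (p : s) : (dirDeriv hs v a).1 p = fderiv ℝ f p v := by
  rw [dirDeriv_apply, (zeroExt_eventuallyEq hs hf p).fderiv_eq]

lemma dirDeriv_comm (hs : IsOpen s) (v w : E) (a : smoothFun s) :
    dirDeriv hs v (dirDeriv hs w a) = dirDeriv hs w (dirDeriv hs v a) := by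
  have key (v w : E) (p : s) : (dirDeriv hs v (dirDeriv hs w a)).1 p
      = fderiv ℝ (fderiv ℝ (zeroExt a)) p v w := by
    have hd : DifferentiableAt ℝ (fderiv ℝ (zeroExt a)) p :=
      ((zeroExt_contDiffAt hs a p).fderiv_right (m := 1) (by norm_cast)).differentiableAt (by simp)
    rw [dirDeriv_eq hs v (f := fun q => fderiv ℝ (zeroExt a) q w) (fun _ => rfl) p,
      fderiv_clm_apply hd (differentiableAt_const w)]
    simp
  ext p
  rw [key, key]
  exact ((zeroExt_contDiffAt hs a p).isSymmSndFDerivAt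
    (by rw [minSmoothness_of_isRCLikeNormedField]; exact WithTop.coe_le_coe.2 le_top)).eq v w

end SmoothFunctions

section SlitBundle

variable {n : ℕ} {U : Set (Vec n)}

lemma isOpen_prod_slit (hU : IsOpen U) : IsOpen (U ×ˢ slit n) :=
  hU.prod isOpen_ne

/-- The coordinate frame on the slit tangent bundle over `U`. -/
def slitFrame (hU : IsOpen U) : TangentFrame (Fin n) (smoothFun (U ×ˢ slit n)) where
  X i := dirDeriv (isOpen_prod_slit hU) (Pi.single i 1, 0)
  Y i := dirDeriv (isOpen_prod_slit hU) (0, Pi.single i 1)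
  y i := ⟨fun p => p.1.2 i, fun p => p.2 i, by fun_prop, fun _ => rfl⟩
  X_comm _ _ a := dirDeriv_comm _ _ _ a
  Y_comm _ _ a := dirDeriv_comm _ _ _ a
  XY_comm _ _ a := dirDeriv_comm _ _ _ a
  X_y i j := by
    ext p
    rw [dirDeriv_eq _ _ (f := fun p => p.2 j) fun _ => rfl]
    erw [((ContinuousLinearMap.proj (R := ℝ) (φ := fun _ : Fin n => ℝ) j).comp
      (ContinuousLinearMap.snd ℝ (Vec n) (Vec n))).hasFDerivAt.fderiv]
    simp
  Y_y i j := by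
    ext p
    rw [dirDeriv_eq _ _ (f := fun p => p.2 j) fun _ => rfl]
    erw [((ContinuousLinearMap.proj (R := ℝ) (φ := fun _ : Fin n => ℝ) j).comp
      (ContinuousLinearMap.snd ℝ (Vec n) (Vec n))).hasFDerivAt.fderiv]
    by_cases h : i = j <;> simp [h, eq_comm]

/-- The function `f` restricts on the slit tangent bundle over `U` to the smooth function `a`. -/
def Represents (f : Vec n → Vec n → ℝ) (a : smoothFun (U ×ˢ slit n)) : Prop :=
  ∀ p : (U ×ˢ slit n : Set (Vec n × Vec n)), f p.1.1 p.1.2 = a.1 p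

namespace Represents

variable {f g : Vec n → Vec n → ℝ} {a b : smoothFun (U ×ˢ slit n)}

lemma add (hf : Represents f a) (hg : Represents g b) :
    Represents (fun x y => f x y + g x y) (a + b) := fun p => by simp [hf p, hg p]

lemma sub (hf : Represents f a) (hg : Represents g b) :
    Represents (fun x y => f x y - g x y) (a - b) := fun p => by simp [hf p, hg p]

lemma mul (hf : Represents f a) (hg : Represents g b) :
    Represents (fun x y => f x y * g x y) (a * b) := fun p => by simp [hf p, hg p]

lemma const_mul (r : ℝ) (hf : Represents f a) :
    Represents (fun x y => r * f x y) (r • a) := fun p => by simp [hf p]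

lemma two_mul (hf : Represents f a) :
    Represents (fun x y => 2 * f x y) (2 * a) := fun p => by simp [hf p, _root_.two_mul]

lemma div_const (r : ℝ) (hf : Represents f a) :
    Represents (fun x y => f x y / r) (r⁻¹ • a) := fun p => by
  simp [hf p, div_eq_inv_mul]

lemma sum {ι : Type*} {t : Finset ι} {f : ι → Vec n → Vec n → ℝ}
    {a : ι → smoothFun (U ×ˢ slit n)} (h : ∀ i, Represents (f i) (a i)) :
    Represents (fun x y => ∑ i ∈ t, f i x y) (∑ i ∈ t, a i) := fun p => by
  simp [h _ p]

lemma fiberCoord (hU : IsOpen U) (i : Fin n) :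
    Represents (fun _ y => y i) ((slitFrame hU).y i) := fun _ => rfl

lemma pdx (hU : IsOpen U) (hf : Represents f a) (i : Fin n) :
    Represents (pdx f i) ((slitFrame hU).X i a) := by
  rintro ⟨⟨x, y⟩, hx, hy⟩
  have hd : DifferentiableAt ℝ (zeroExt a) (x, y) :=
    zeroExt_differentiableAt (isOpen_prod_slit hU) a ⟨(x, y), hx, hy⟩
  have h := hd.hasFDerivAt.comp (f := fun x' => (x', y)) x ((hasFDerivAt_id x).prodMk (hasFDerivAt_const y x))
  have he : (fun x' => f x' y) =ᶠ[nhds x] zeroExt a ∘ fun x' => (x', y) := by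
    filter_upwards [hU.mem_nhds hx] with x' hx'
    exact (hf ⟨(x', y), hx', hy⟩).trans (zeroExt_apply a ⟨(x', y), hx', hy⟩).symm
  change fderiv ℝ (fun x' => f x' y) x (Pi.single i 1) = fderiv ℝ (zeroExt a) (x, y) _
  rw [he.fderiv_eq]
  rw [h.fderiv]
  simp

lemma pdy (hU : IsOpen U) (hf : Represents f a) (i : Fin n) :
    Represents (pdy f i) ((slitFrame hU).Y i a) := by
  rintro ⟨⟨x, y⟩, hx, hy⟩
  have hd : DifferentiableAt ℝ (zeroExt a) (x, y) :=
    zeroExt_differentiableAt (isOpen_prod_slit hU) a ⟨(x, y), hx, hy⟩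
  have h := hd.hasFDerivAt.comp (f := fun y' => (x, y')) y ((hasFDerivAt_const x y).prodMk (hasFDerivAt_id y))
  have he : (fun y' => f x y') =ᶠ[nhds y] zeroExt a ∘ fun y' => (x, y') := by
    filter_upwards [isOpen_ne.mem_nhds hy] with y' hy'
    exact (hf ⟨(x, y'), hx, hy'⟩).trans (zeroExt_apply a ⟨(x, y'), hx, hy'⟩).symm
  change fderiv ℝ (fun y' => f x y') y (Pi.single i 1) = fderiv ℝ (zeroExt a) (x, y) _
  rw [he.fderiv_eq]
  rw [h.fderiv]
  simp

section Spray

variable {G : Fin n → Vec n → Vec n → ℝ} {γ : Fin n → smoothFun (U ×ˢ slit n)}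

lemma hD (hU : IsOpen U) (hG : ∀ i, Represents (G i) (γ i)) (hf : Represents f a) (k : Fin n) :
    Represents (hD G f k) ((slitFrame hU).δ γ k a) := by
  rw [TangentFrame.δ_apply]
  exact (hf.pdx hU k).sub (sum fun l => ((hG l).pdy hU k).mul (hf.pdy hU l))

lemma Γc (hU : IsOpen U) (hG : ∀ i, Represents (G i) (γ i)) (i j k : Fin n) :
    Represents (Γc G i j k) ((slitFrame hU).Y k ((slitFrame hU).Y j (γ i))) :=
  ((hG i).pdy hU j).pdy hU k

lemma covD1 (hU : IsOpen U) (hG : ∀ i, Represents (G i) (γ i))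
    {B : Fin n → Vec n → Vec n → ℝ} {β : Fin n → smoothFun (U ×ˢ slit n)}
    (hB : ∀ i, Represents (B i) (β i)) (j m : Fin n) :
    Represents (covD1 G B j m) ((slitFrame hU).cov1 γ β j m) :=
  ((hB j).hD hU hG m).sub (sum fun l => (hB l).mul (Γc hU hG l j m))

lemma covD11 (hU : IsOpen U) (hG : ∀ i, Represents (G i) (γ i))
    {B : Fin n → Fin n → Vec n → Vec n → ℝ} {β : Fin n → Fin n → smoothFun (U ×ˢ slit n)}
    (hB : ∀ i j, Represents (B i j) (β i j)) (i j m : Fin n) :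
    Represents (covD11 G B i j m) ((slitFrame hU).cov11 γ β i j m) :=
  (((hB i j).hD hU hG m).add (sum fun l => (hB l j).mul (Γc hU hG i l m))).sub
    (sum fun l => (hB i l).mul (Γc hU hG l j m))

lemma Riem (hU : IsOpen U) (hG : ∀ i, Represents (G i) (γ i)) (i k : Fin n) :
    Represents (Riem G i k) ((slitFrame hU).riem γ i k) :=
  ((((hG i).pdx hU k).two_mul.sub
    (sum fun j => (fiberCoord hU j).mul (((hG i).pdx hU j).pdy hU k))).add
      (sum fun j => (hG j).mul (Γc hU hG i j k)).two_mul).sub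
        (sum fun s => ((hG i).pdy hU s).mul ((hG s).pdy hU k))

lemma Ricci (hU : IsOpen U) (hG : ∀ i, Represents (G i) (γ i)) :
    Represents (Ricci G) (((n : ℝ) - 1)⁻¹ • (slitFrame hU).ric γ) :=
  (sum fun m => Riem hU hG m m).div_const _

lemma Ghat (hU : IsOpen U) (hG : ∀ i, Represents (G i) (γ i)) {σ : Vec n → ℝ}
    {g : smoothFun (U ×ˢ slit n)} (hg : Represents (fun x _ => Real.log (σ x)) g) (i : Fin n) :
    Represents (Ghat G σ i) ((slitFrame hU).proj γ g ((n : ℝ) + 1)⁻¹ i) :=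
  (hG i).sub ((((sum fun m => (hG m).pdy hU m).sub
    (sum fun m => (fiberCoord hU m).mul (hg.pdx hU m))).div_const _).mul (fiberCoord hU i))

end Spray

end Represents

lemma represents_of_contDiffOn {f : Vec n → Vec n → ℝ}
    (hf : ContDiffOn ℝ (⊤ : ℕ∞) (fun p : Vec n × Vec n => f p.1 p.2) (U ×ˢ slit n)) :
    Represents f (⟨fun p => f p.1.1 p.1.2, _, hf, fun _ => rfl⟩ : smoothFun (U ×ˢ slit n)) :=
  fun _ => rfl

lemma IsSpray.euler2 (hU : IsOpen U) {G : Fin n → Vec n → Vec n → ℝ} (hG : IsSpray U G)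
    {γ : Fin n → smoothFun (U ×ˢ slit n)} (hγ : ∀ i, Represents (G i) (γ i)) :
    (slitFrame hU).Euler2 γ := by
  intro i
  ext ⟨⟨x, y⟩, hx, hy⟩
  have hdiff : DifferentiableAt ℝ (G i x) y := by
    have h := ((hG.1 i).contDiffAt ((isOpen_prod_slit hU).mem_nhds
      (show (x, y) ∈ U ×ˢ slit n from ⟨hx, hy⟩))).differentiableAt (by simp)
    exact h.comp (f := fun y' => (x, y')) y (by fun_prop)
  have h₁ : HasDerivAt (fun c : ℝ => G i x (c • y)) (fderiv ℝ (G i x) y y) 1 := by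
    have hc : HasDerivAt (fun c : ℝ => c • y) y 1 := by
      simpa using (hasDerivAt_id (1 : ℝ)).smul_const y
    have hd : HasFDerivAt (G i x) (fderiv ℝ (G i x) y) ((1 : ℝ) • y) := by
      simpa using hdiff.hasFDerivAt
    exact hd.comp_hasDerivAt 1 hc
  have h₂ : HasDerivAt (fun c : ℝ => G i x (c • y)) (2 * G i x y) 1 := by
    have h : HasDerivAt (fun c : ℝ => c ^ 2 * G i x y) (2 * G i x y) 1 := by
      simpa using (hasDerivAt_pow 2 (1 : ℝ)).mul_const (G i x y)
    refine h.congr_of_eventuallyEq ?_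
    filter_upwards [lt_mem_nhds one_pos] with c hc
    exact hG.2 i x hx y hy c hc
  have hEuler : ∑ j, y j * pdy (G i) j x y = 2 * G i x y := by
    rw [← h₁.unique h₂]
    have hy' : y = ∑ j, y j • (Pi.single j 1 : Vec n) := pi_eq_sum_univ' y
    have h := congrArg (fderiv ℝ (G i x) y) hy'
    rw [map_sum] at h
    rw [h]
    refine Finset.sum_congr rfl fun j _ => ?_
    rw [map_smul, smul_eq_mul]
    rfl
  have hL := Represents.sum (t := Finset.univ) (fun j => (Represents.fiberCoord hU j).mul
    ((hγ i).pdy hU j)) ⟨(x, y), hx, hy⟩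
  have hR := (hγ i).two_mul ⟨(x, y), hx, hy⟩
  exact hL.symm.trans (hEuler.trans hR)

end SlitBundle

/-- Equation (3.5): `W^o_k = (1/(n-1)) R̂^m_{k∥m}`, where `R̂^i_k` is the Riemann curvature
of the projective spray `Ĝ` and `∥` is taken with respect to `Ĝ`. -/
theorem stmt_19 {n : ℕ} (hn : 2 ≤ n) (U : Set (Vec n)) (hU : IsOpen U) (hUne : U.Nonempty)
    (G : Fin n → Vec n → Vec n → ℝ) (hG : IsSpray U G)
    (σ : Vec n → ℝ) (hσ : IsVolumeForm U σ) :
    ∀ x ∈ U, ∀ y ∈ slit n, ∀ k : Fin n,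
      BWeyl G σ k x y =
        (1/((n : ℝ) - 1)) * ∑ m, covD11 (Ghat G σ) (Riem (Ghat G σ)) m k m x y := by
  rintro x hx y hy k
  have hγ (i : Fin n) := represents_of_contDiffOn (hG.1 i)
  have hlog : ContDiffOn ℝ (⊤ : ℕ∞) (fun p : Vec n × Vec n => Real.log (σ p.1))
      (U ×ˢ slit n) :=
    (hσ.1.comp contDiffOn_fst fun p hp => hp.1).log fun p hp => (hσ.2 p.1 hp.1).ne'
  have hg := represents_of_contDiffOn (f := fun x _ => Real.log (σ x)) hlog
  have hgY (i : Fin n) : (slitFrame hU).Y i ⟨_, _, hlog, fun _ => rfl⟩ = 0 := by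
    ext p
    rw [← hg.pdy hU i p]
    simp [pdy]
  have hE := hG.euler2 hU hγ
  have hn' : ((n : ℝ) + 1)⁻¹ * (Fintype.card (Fin n) + 1) = 1 := by
    rw [Fintype.card_fin]
    exact inv_mul_cancel₀ (by positivity)
  have hĜ := Represents.Ghat hU hγ hg
  have key := (hE.proj hgY _).berwaldWeyl_eq hgY (hE.sum_Y_proj hgY hn') ((n : ℝ) - 1)⁻¹ k
  have hRic := Represents.Ricci hU hĜ
  have hL := (hRic.hD hU hĜ k).sub (.const_mul (1 / 2) (.sum (t := Finset.univ) fun m =>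
    (Represents.covD1 hU hĜ (fun j => hRic.pdy hU j) k m).mul (.fiberCoord hU m)))
  have hR := Represents.const_mul ((n : ℝ) - 1)⁻¹ (.sum (t := Finset.univ) fun m =>
    Represents.covD11 hU hĜ (Represents.Riem hU hĜ) m k m)
  rw [key] at hL
  rw [one_div]
  exact (hL ⟨(x, y), hx, hy⟩).trans (hR ⟨(x, y), hx, hy⟩).symm

end BerwaldWeyl
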